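/- Let A be a J-algebra, let e ∈ A with e ≤ 1', and let X = {x ∈ A : x;x˘ = e and x˘;x = e}. Then (X, ;, ˘, e) is a group: e ∈ X, X is closed under ; and under ˘, e;x = x = x;e for all x ∈ X, ; is associative, and x˘ is a two-sided inverse of x with respect to e for every x ∈ X. -/

import Mathlib

/-- A J-algebra: an algebra (A, ·, 0, 1, ;, ˘, 1') satisfying Jónsson's axioms. -/
structure JAlgebra (A : Type*) where
  meet : A → A → A        -- Boolean product ·
  comp : A → A → A        -- relative product ;
  conv : A → A            -- converse ˘
  zero : A                -- 0
  one : A                 -- 1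
  ident : A               -- 1'
  massoc : ∀ x y z, meet x (meet y z) = meet (meet x y) z
  mcomm : ∀ x y, meet x y = meet y x
  midem : ∀ x, meet x x = x
  cassoc : ∀ x y z, comp x (comp y z) = comp (comp x y) z
  cid : ∀ x, comp x ident = x
  semidist : ∀ x y z, comp (meet x y) z = meet (comp (meet x y) z) (comp y z)
  convconv : ∀ x, conv (conv x) = x
  convcomp : ∀ x y, conv (comp x y) = comp (conv y) (conv x)
  convmeet : ∀ x y, conv (meet x y) = meet (conv x) (conv y)
  rot : ∀ x y z, meet (comp x y) z =
    meet (comp (meet (comp z (conv y)) x) (meet y (comp (conv x) z))) z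
  zbot : ∀ x, meet zero x = zero
  otop : ∀ x, meet x one = x
  comp_zero : ∀ x, comp x zero = zero

/-- x ≤ y iff x·y = x. -/
def JAlgebra.le {A : Type*} (J : JAlgebra A) (x y : A) : Prop := J.meet x y = x

/-- x is functional iff x˘;x ≤ 1'. -/
def JAlgebra.Functional {A : Type*} (J : JAlgebra A) (x : A) : Prop :=
  J.le (J.comp (J.conv x) x) J.ident

/-- x is permutational iff x;x˘ = 1' = x˘;x. -/
def JAlgebra.Permutational {A : Type*} (J : JAlgebra A) (x : A) : Prop :=
  J.comp x (J.conv x) = J.ident ∧ J.comp (J.conv x) x = J.ident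

namespace JAlgebra

variable {A : Type*} (J : JAlgebra A)

theorem le_trans {x y z : A} (hxy : J.le x y) (hyz : J.le y z) : J.le x z := by
  unfold le at *
  rw [← hxy, ← J.massoc, hyz]

theorem le_antisymm {x y : A} (hxy : J.le x y) (hyx : J.le y x) : x = y := by
  unfold le at *
  rw [← hxy, J.mcomm, hyx]

theorem meet_le_right (x y : A) : J.le (J.meet x y) y := by
  unfold le
  rw [← J.massoc, J.midem]

theorem conv_mono {x y : A} (h : J.le x y) : J.le (J.conv x) (J.conv y) := by
  unfold le at *
  rw [← J.convmeet, h]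

theorem comp_mono_left {x y : A} (h : J.le x y) (z : A) :
    J.le (J.comp x z) (J.comp y z) := by
  have := J.semidist x y z
  unfold le at *
  rw [h] at this
  exact this.symm

theorem comp_mono_right {x y : A} (h : J.le x y) (z : A) :
    J.le (J.comp z x) (J.comp z y) := by
  have := J.conv_mono (J.comp_mono_left (J.conv_mono h) (J.conv z))
  simpa only [J.convcomp, J.convconv] using this

theorem conv_ident : J.conv J.ident = J.ident := by
  have h := J.convcomp (J.conv J.ident) J.ident
  rwa [J.cid, J.convconv, J.cid, eq_comm] at h

theorem ident_comp (x : A) : J.comp J.ident x = x := by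
  have h := J.convcomp (J.conv x) J.ident
  rwa [J.cid, J.convconv, J.conv_ident, eq_comm] at h

theorem le_comp_conv_comp (x : A) : J.le x (J.comp x (J.comp (J.conv x) x)) := by
  have h := J.rot x J.ident x
  rw [J.cid, J.conv_ident, J.cid, J.midem, J.mcomm _ x] at h
  have h' : J.le x (J.comp x (J.meet J.ident (J.comp (J.conv x) x))) := h.symm
  exact J.le_trans h' (J.comp_mono_right (J.meet_le_right _ _) x)

variable {J}

theorem conv_eq_of_le_ident {e : A} (he : J.le e J.ident) : J.conv e = e := by
  have key : ∀ a, J.le a J.ident → J.le a (J.conv a) := fun a ha => by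
    have h₁ := J.comp_mono_left ha (J.comp (J.conv a) a)
    have h₂ := J.comp_mono_right ha (J.conv a)
    rw [J.ident_comp] at h₁
    rw [J.cid] at h₂
    exact J.le_trans (J.le_comp_conv_comp a) (J.le_trans h₁ h₂)
  have he' := J.conv_mono he
  rw [J.conv_ident] at he'
  have h := key _ he'
  rw [J.convconv] at h
  exact J.le_antisymm h (key e he)

theorem comp_self_of_le_ident {e : A} (he : J.le e J.ident) : J.comp e e = e := by
  have h₁ := J.comp_mono_right he e
  have h₂ := J.le_comp_conv_comp e
  have h₃ := J.comp_mono_left he (J.comp e e)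
  rw [J.cid] at h₁
  rw [conv_eq_of_le_ident he] at h₂
  rw [J.ident_comp] at h₃
  exact J.le_antisymm h₁ (J.le_trans h₂ h₃)

theorem comp_eq_of_conv_comp_eq {e x : A} (he : J.le e J.ident)
    (hx : J.comp (J.conv x) x = e) : J.comp x e = x := by
  have h₁ := J.le_comp_conv_comp x
  have h₂ := J.comp_mono_right he x
  rw [hx] at h₁
  rw [J.cid] at h₂
  exact J.le_antisymm h₂ h₁

theorem comp_comp_conv {e x y : A} (he : J.le e J.ident) (hxx : J.comp (J.conv x) x = e)
    (hx : J.comp x (J.conv x) = e) (hy : J.comp y (J.conv y) = e) :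
    J.comp (J.comp x y) (J.conv (J.comp x y)) = e := by
  rw [J.convcomp, J.cassoc, ← J.cassoc x, hy, comp_eq_of_conv_comp_eq he hxx, hx]

end JAlgebra

/-- For e ≤ 1', the set X = {x : x;x˘ = e = x˘;x} forms a group under ;, ˘
with identity e. -/
theorem subidentity_group {A : Type*} (J : JAlgebra A) (e : A)
    (he : J.le e J.ident) :
    let X : Set A := {x | J.comp x (J.conv x) = e ∧ J.comp (J.conv x) x = e}
    e ∈ X ∧
    (∀ x ∈ X, ∀ y ∈ X, J.comp x y ∈ X) ∧
    (∀ x ∈ X, J.conv x ∈ X) ∧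
    (∀ x ∈ X, J.comp e x = x ∧ J.comp x e = x) ∧
    (∀ x y z : A, J.comp x (J.comp y z) = J.comp (J.comp x y) z) ∧
    (∀ x ∈ X, J.comp x (J.conv x) = e ∧ J.comp (J.conv x) x = e) := by
  intro X
  have hconv : ∀ x ∈ X, J.conv x ∈ X := fun x hx => by
    simpa only [X, Set.mem_ofPred_eq, J.convconv] using hx.symm
  refine ⟨?_, ?_, hconv, ?_, J.cassoc, fun x hx => hx⟩
  · have hc := JAlgebra.conv_eq_of_le_ident he
    have hs := JAlgebra.comp_self_of_le_ident he
    simp only [X, Set.mem_ofPred_eq, hc, hs, and_self]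
  · intro x hx y hy
    refine ⟨JAlgebra.comp_comp_conv he hx.2 hx.1 hy.1, ?_⟩
    have h := JAlgebra.comp_comp_conv he (hconv y hy).2 (hconv y hy).1 (hconv x hx).1
    rwa [← J.convcomp, J.convconv] at h
  · intro x hx
    refine ⟨?_, JAlgebra.comp_eq_of_conv_comp_eq he hx.2⟩
    have h := congrArg J.conv (JAlgebra.comp_eq_of_conv_comp_eq he (hconv x hx).2)
    rwa [J.convcomp, J.convconv, JAlgebra.conv_eq_of_le_ident he] at h
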